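/- (Buckley, weak type.) Let 1<p<∞ and let w ∈ A_p on ℝ^d. Then the Hardy–Littlewood maximal operator satisfies the weak-type bound λ^p · w({Mf > λ}) ≤ C^p ‖w‖_{A_p} ‖f‖_{L^p(w)}^p for all f ∈ L^p(w) and λ > 0, i.e. ‖M‖_{L^p(w) → L^{p,∞}(w)} ≤ C ‖w‖_{A_p}^{1/p}, where C depends only on p and d. -/

import Mathlib

open MeasureTheory Set ENNReal

noncomputable section

/-- An axis-parallel cube in `ℝ^d` with corner `x` and side length `h`. -/
def cube (d : ℕ) (x : Fin d → ℝ) (h : ℝ) : Set (Fin d → ℝ) :=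
  Set.univ.pi fun i => Set.Ico (x i) (x i + h)

/-- The average of (the nonnegative part of) `w` over a set `I`, valued in `ℝ≥0∞`. -/
def lavg (d : ℕ) (w : (Fin d → ℝ) → ℝ) (I : Set (Fin d → ℝ)) : ℝ≥0∞ :=
  (volume I)⁻¹ * ∫⁻ y in I, ENNReal.ofReal (w y)

/-- The `A_p` characteristic of a weight `w` on `ℝ^d`:
the supremum over all cubes `I` of `(|I|⁻¹∫_I w)·(|I|⁻¹∫_I w^{-1/(p-1)})^{p-1}`. -/
def ApChar (d : ℕ) (p : ℝ) (w : (Fin d → ℝ) → ℝ) : ℝ≥0∞ :=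
  ⨆ (x : Fin d → ℝ) (h : Set.Ioi (0:ℝ)),
    lavg d w (cube d x h) *
      (lavg d (fun y => w y ^ (-1 / (p - 1))) (cube d x h)) ^ (p - 1)

/-- A weight on `ℝ^d`: a measurable, locally integrable, a.e. positive function. -/
def IsWeight (d : ℕ) (w : (Fin d → ℝ) → ℝ) : Prop :=
  Measurable w ∧ LocallyIntegrable w volume ∧ ∀ᵐ x : Fin d → ℝ, 0 < w x

/-- The Hardy–Littlewood maximal function
`Mf(x) := sup_{t>0} (2t)^{−d} ∫_{[−t,t]^d} |f(x−u)| du`, valued in `ℝ≥0∞`. -/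
def maximalFn (d : ℕ) (f : (Fin d → ℝ) → ℝ) (x : Fin d → ℝ) : ℝ≥0∞ :=
  ⨆ t : Set.Ioi (0:ℝ),
    (ENNReal.ofReal ((2 * (t:ℝ)) ^ d))⁻¹ *
      ∫⁻ u in Set.univ.pi fun _ : Fin d => Set.Icc (-(t:ℝ)) (t:ℝ), (‖f (x - u)‖₊ : ℝ≥0∞)

/-- Hölder's inequality against a weight `w` and its dual weight `w ^ (-1 / (p - 1))`. -/
theorem lintegral_rpow_le_mul_dual_weight {α : Type*} [MeasurableSpace α] (μ : Measure α)
    {p : ℝ} (hp : 1 < p) {w f : α → ℝ} (hw : Measurable w) (hpos : ∀ᵐ x ∂μ, 0 < w x)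
    (hf : Measurable f) :
    (∫⁻ x, (‖f x‖₊ : ℝ≥0∞) ∂μ) ^ p ≤
      (∫⁻ x, (‖f x‖₊ : ℝ≥0∞) ^ p * ENNReal.ofReal (w x) ∂μ) *
        (∫⁻ x, ENNReal.ofReal (w x ^ (-1 / (p - 1))) ∂μ) ^ (p - 1) := by
  have hp0 : 0 < p := by linarith
  have hp1 : 0 < p - 1 := by linarith
  have hpq := Real.HolderConjugate.conjExponent hp
  set q := Real.conjExponent p
  have hqv : q = p / (p - 1) := rfl
  let F : α → ℝ≥0∞ := fun x => (‖f x‖₊ : ℝ≥0∞) * ENNReal.ofReal (w x) ^ (1 / p)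
  let G : α → ℝ≥0∞ := fun x => ENNReal.ofReal (w x) ^ (-(1 / p))
  have hF : Measurable F := by fun_prop
  have hG : Measurable G := by fun_prop
  have hFG : ∫⁻ x, (‖f x‖₊ : ℝ≥0∞) ∂μ = ∫⁻ x, (F * G) x ∂μ := by
    refine lintegral_congr_ae ?_
    filter_upwards [hpos] with x hx
    have h0 : ENNReal.ofReal (w x) ≠ 0 := by simpa using hx
    simp only [F, G, Pi.mul_apply]
    rw [mul_assoc, ← ENNReal.rpow_add _ _ h0 ENNReal.ofReal_ne_top]
    simp
  have hFp : ∫⁻ x, F x ^ p ∂μ = ∫⁻ x, (‖f x‖₊ : ℝ≥0∞) ^ p * ENNReal.ofReal (w x) ∂μ := by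
    refine lintegral_congr fun x => ?_
    simp only [F]
    rw [ENNReal.mul_rpow_of_nonneg _ _ hp0.le, ← ENNReal.rpow_mul, one_div_mul_cancel hp0.ne',
      ENNReal.rpow_one]
  have hGq : ∫⁻ x, G x ^ q ∂μ = ∫⁻ x, ENNReal.ofReal (w x ^ (-1 / (p - 1))) ∂μ := by
    refine lintegral_congr_ae ?_
    filter_upwards [hpos] with x hx
    simp only [G]
    rw [← ENNReal.rpow_mul, ENNReal.ofReal_rpow_of_pos hx, hqv]
    congr 2
    field_simp
  have key := ENNReal.lintegral_mul_le_Lp_mul_Lq μ hpq hF.aemeasurable hG.aemeasurable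
  rw [← hFG, hFp, hGq] at key
  refine (ENNReal.rpow_le_rpow key hp0.le).trans_eq ?_
  rw [ENNReal.mul_rpow_of_nonneg _ _ hp0.le, ← ENNReal.rpow_mul, ← ENNReal.rpow_mul,
    one_div_mul_cancel hp0.ne', ENNReal.rpow_one, hqv]
  congr 2
  field_simp

/-- The integral of `|f(x - ·)|` over a centred cube is that of `|f|` over a sup-norm ball. -/
theorem setLIntegral_sub_left_eq_closedBall (d : ℕ) (f : (Fin d → ℝ) → ℝ) (x : Fin d → ℝ)
    {t : ℝ} (ht : 0 ≤ t) :
    ∫⁻ u in Set.univ.pi fun _ : Fin d => Set.Icc (-t) t, (‖f (x - u)‖₊ : ℝ≥0∞) =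
      ∫⁻ y in Metric.closedBall x t, (‖f y‖₊ : ℝ≥0∞) := by
  have hpre : (Set.univ.pi fun _ : Fin d => Set.Icc (-t) t) =
      (fun u => x - u) ⁻¹' Metric.closedBall x t := by
    ext u
    simp [pi_norm_le_iff_of_nonneg ht, abs_le, Pi.le_def, forall_and]
  rw [hpre]
  exact (Measure.measurePreserving_sub_left volume x).setLIntegral_comp_preimage_emb
    (MeasurableEquiv.subLeft x).measurableEmbedding (fun y => (‖f y‖₊ : ℝ≥0∞))
    (Metric.closedBall x t)

theorem volume_cube (d : ℕ) (x : Fin d → ℝ) {h : ℝ} (hh : 0 ≤ h) :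
    volume (cube d x h) = ENNReal.ofReal (h ^ d) := by
  simp [cube, Real.volume_pi_Ico, ENNReal.ofReal_pow hh]

theorem closedBall_subset_cube (d : ℕ) (x : Fin d → ℝ) {r s : ℝ} (hr : 0 ≤ r) (hrs : r < s) :
    Metric.closedBall x r ⊆ cube d (fun i => x i - s) (2 * s) := by
  intro y hy i _
  have h := abs_le.1 ((Real.dist_eq _ _).symm.trans_le ((dist_pi_le_iff hr).1 hy i))
  exact ⟨by linarith [h.1], by linarith [h.2]⟩

/-- The `A_p` condition on a single cube, with the averages cleared of denominators. -/
theorem lintegral_mul_dual_rpow_le_ApChar (d : ℕ) {p : ℝ} (hp : 1 < p)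
    (w : (Fin d → ℝ) → ℝ) (x : Fin d → ℝ) {h : ℝ} (hh : 0 < h) :
    (∫⁻ y in cube d x h, ENNReal.ofReal (w y)) *
        (∫⁻ y in cube d x h, ENNReal.ofReal (w y ^ (-1 / (p - 1)))) ^ (p - 1) ≤
      ENNReal.ofReal (h ^ d) ^ p * ApChar d p w := by
  have hle : lavg d w (cube d x h) *
      (lavg d (fun y => w y ^ (-1 / (p - 1))) (cube d x h)) ^ (p - 1) ≤ ApChar d p w :=
    le_iSup₂_of_le x (⟨h, hh⟩ : Set.Ioi (0 : ℝ)) le_rfl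
  have hV0 : ENNReal.ofReal (h ^ d) ≠ 0 := by simpa using pow_pos hh d
  simp only [lavg, volume_cube d x hh.le] at hle
  set V := ENNReal.ofReal (h ^ d)
  have hVt : V ≠ ⊤ := ENNReal.ofReal_ne_top
  rw [ENNReal.mul_rpow_of_nonneg _ _ (by linarith : (0 : ℝ) ≤ p - 1)] at hle
  have hVp : V ^ p * (V⁻¹ * V⁻¹ ^ (p - 1)) = 1 := by
    rw [← ENNReal.rpow_neg_one, ← ENNReal.rpow_mul, ← ENNReal.rpow_add _ _ hV0 hVt,
      ← ENNReal.rpow_add _ _ hV0 hVt]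
    ring_nf
    simp
  refine le_trans (le_of_eq ?_) (mul_le_mul_right hle (V ^ p))
  rw [mul_mul_mul_comm, ← mul_assoc, hVp, one_mul]

/-- If the average of `|f|` over a ball exceeds `lam`, then the weight of the five times larger
ball is controlled by the integral of `|f| ^ p * w` over the original ball. -/
theorem rpow_mul_lintegral_enlarged_ball_le (d : ℕ) {p : ℝ} (hp : 1 < p)
    {w f : (Fin d → ℝ) → ℝ} (hw : Measurable w) (hpos : ∀ᵐ x : Fin d → ℝ, 0 < w x)
    (hf : Measurable f) {lam : ℝ} (hlam : 0 < lam) (x : Fin d → ℝ) {t : ℝ} (ht : 0 < t)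
    (hx : ENNReal.ofReal lam < (ENNReal.ofReal ((2 * t) ^ d))⁻¹ *
      ∫⁻ y in Metric.closedBall x t, (‖f y‖₊ : ℝ≥0∞)) :
    ENNReal.ofReal (lam ^ p) *
        (∫⁻ y in Metric.closedBall x (5 * t), ENNReal.ofReal (w y)) ≤
      ENNReal.ofReal ((6 ^ d : ℝ) ^ p) * ApChar d p w *
        ∫⁻ y in Metric.closedBall x t, (‖f y‖₊ : ℝ≥0∞) ^ p * ENNReal.ofReal (w y) := by
  have hp0 : 0 < p := by linarith
  set V := ENNReal.ofReal ((2 * t) ^ d) with hV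
  have hV0 : V ≠ 0 := by simpa [hV] using pow_pos (by linarith : 0 < 2 * t) d
  have hVt : V ≠ ⊤ := ENNReal.ofReal_ne_top
  set Q := cube d (fun i => x i - 6 * t) (2 * (6 * t)) with hQ
  have hVQ : ENNReal.ofReal ((2 * (6 * t)) ^ d) = ENNReal.ofReal (6 ^ d) * V := by
    rw [hV, ← ENNReal.ofReal_mul (by positivity), ← mul_pow]
    ring_nf
  have h5 : Metric.closedBall x (5 * t) ⊆ Q :=
    closedBall_subset_cube d x (by linarith) (by linarith)
  have h1 : Metric.closedBall x t ⊆ Q := closedBall_subset_cube d x ht.le (by linarith)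
  set I := ∫⁻ y in Metric.closedBall x t, (‖f y‖₊ : ℝ≥0∞)
  set Φ := ∫⁻ y in Metric.closedBall x t, (‖f y‖₊ : ℝ≥0∞) ^ p * ENNReal.ofReal (w y)
  set S := ∫⁻ y in Q, ENNReal.ofReal (w y ^ (-1 / (p - 1)))
  have hI : V * ENNReal.ofReal lam ≤ I := by
    calc V * ENNReal.ofReal lam ≤ V * (V⁻¹ * I) := by gcongr
      _ = I := by rw [← mul_assoc, ENNReal.mul_inv_cancel hV0 hVt, one_mul]
  have hHolder : I ^ p ≤ Φ * S ^ (p - 1) := by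
    refine (lintegral_rpow_le_mul_dual_weight _ hp hw (ae_restrict_of_ae hpos) hf).trans ?_
    gcongr
    exact lintegral_mono_set h1
  have hAp := lintegral_mul_dual_rpow_le_ApChar d hp w (fun i => x i - 6 * t)
    (by linarith : 0 < 2 * (6 * t))
  rw [← hQ, hVQ, ENNReal.mul_rpow_of_nonneg _ _ hp0.le,
    ENNReal.ofReal_rpow_of_nonneg (by positivity) hp0.le] at hAp
  have hVp0 : V ^ p ≠ 0 := (ENNReal.rpow_pos (pos_iff_ne_zero.2 hV0) hVt).ne'
  have hVpt : V ^ p ≠ ⊤ := ENNReal.rpow_ne_top_of_nonneg hp0.le hVt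
  rw [← ENNReal.mul_le_mul_iff_right hVp0 hVpt]
  calc V ^ p * (ENNReal.ofReal (lam ^ p) *
        ∫⁻ y in Metric.closedBall x (5 * t), ENNReal.ofReal (w y))
      = (V * ENNReal.ofReal lam) ^ p *
        ∫⁻ y in Metric.closedBall x (5 * t), ENNReal.ofReal (w y) := by
        rw [ENNReal.mul_rpow_of_nonneg _ _ hp0.le,
          ENNReal.ofReal_rpow_of_nonneg hlam.le hp0.le, mul_assoc]
    _ ≤ (Φ * S ^ (p - 1)) * ∫⁻ y in Q, ENNReal.ofReal (w y) := by
        gcongr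
        exact (ENNReal.rpow_le_rpow hI hp0.le).trans hHolder
    _ = Φ * ((∫⁻ y in Q, ENNReal.ofReal (w y)) * S ^ (p - 1)) := by ring
    _ ≤ Φ * (ENNReal.ofReal ((6 ^ d : ℝ) ^ p) * V ^ p * ApChar d p w) := by gcongr
    _ = _ := by ring

/-- **Buckley's weak-type bound.** For `1 < p < ∞` there is a constant `C = C(p,d)` such that
for every `w ∈ A_p` on `ℝ^d`, all `f ∈ L^p(w)` and all `λ > 0`,
`λ^p · w({Mf > λ}) ≤ C^p ‖w‖_{A_p} ‖f‖_{L^p(w)}^p`; that is,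
`‖M‖_{L^p(w) → L^{p,∞}(w)} ≤ C ‖w‖_{A_p}^{1/p}`. -/
theorem buckley_weak_type (d : ℕ) (p : ℝ) (hp : 1 < p) :
    ∃ C : ℝ, 0 < C ∧
      ∀ w : (Fin d → ℝ) → ℝ, IsWeight d w → ApChar d p w < ⊤ →
        ∀ f : (Fin d → ℝ) → ℝ, Measurable f → ∀ lam : ℝ, 0 < lam →
          ENNReal.ofReal (lam ^ p) *
              (∫⁻ x in {x | ENNReal.ofReal lam < maximalFn d f x}, ENNReal.ofReal (w x)) ≤
            ENNReal.ofReal (C ^ p) * ApChar d p w *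
              ∫⁻ x, (‖f x‖₊ : ℝ≥0∞) ^ p * ENNReal.ofReal (w x) := by
  refine ⟨6 ^ d, by positivity, fun w ⟨hw, _, hpos⟩ _ f hf lam hlam => ?_⟩
  let E : ℕ → Set (Fin d → ℝ) := fun n => {x | ∃ t : ℝ, 0 < t ∧ t ≤ n ∧
    ENNReal.ofReal lam < (ENNReal.ofReal ((2 * t) ^ d))⁻¹ *
      ∫⁻ y in Metric.closedBall x t, (‖f y‖₊ : ℝ≥0∞)}
  have hEmono : Monotone E := by
    rintro m n hmn x ⟨t, ht, htm, h⟩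
    exact ⟨t, ht, htm.trans (by exact_mod_cast hmn), h⟩
  have hEU : {x | ENNReal.ofReal lam < maximalFn d f x} ⊆ ⋃ n, E n := by
    intro x hx
    obtain ⟨⟨t, ht⟩, h⟩ := lt_iSup_iff.1 (show ENNReal.ofReal lam < maximalFn d f x from hx)
    have ht' : 0 < t := ht
    obtain ⟨n, hn⟩ := exists_nat_ge t
    rw [setLIntegral_sub_left_eq_closedBall d f x ht'.le] at h
    exact mem_iUnion.2 ⟨n, t, ht', hn, h⟩
  refine (mul_le_mul_right (lintegral_mono_set hEU) _).trans ?_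
  rw [← withDensity_apply' _ (⋃ n, E n), hEmono.measure_iUnion, ENNReal.mul_iSup]
  refine iSup_le fun n => ?_
  rw [withDensity_apply']
  choose! r hr0 hrn hr using fun x (hx : x ∈ E n) => hx
  obtain ⟨u, huE, hdisj, hcov⟩ := Vitali.exists_disjoint_subfamily_covering_enlargement_closedBall
    (E n) id r n hrn 5 (by norm_num)
  have hu : u.Countable := hdisj.countable_of_nonempty_interior fun x hx =>
    ⟨x, Metric.ball_subset_interior_closedBall (Metric.mem_ball_self (hr0 x (huE hx)))⟩
  have : Countable u := hu.to_subtype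
  have hsub : E n ⊆ ⋃ x : u, Metric.closedBall (x : Fin d → ℝ) (5 * r x) := by
    intro x hx
    obtain ⟨b, hb, h⟩ := hcov x hx
    exact mem_iUnion.2 ⟨⟨b, hb⟩, h (Metric.mem_closedBall_self (hr0 x hx).le)⟩
  calc ENNReal.ofReal (lam ^ p) * ∫⁻ x in E n, ENNReal.ofReal (w x)
      ≤ ENNReal.ofReal (lam ^ p) *
        ∑' x : u, ∫⁻ y in Metric.closedBall (x : Fin d → ℝ) (5 * r x), ENNReal.ofReal (w y) := by
        gcongr
        exact (lintegral_mono_set hsub).trans (lintegral_iUnion_le _ _)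
    _ ≤ ∑' x : u, ENNReal.ofReal ((6 ^ d : ℝ) ^ p) * ApChar d p w *
        ∫⁻ y in Metric.closedBall (x : Fin d → ℝ) (r x),
          (‖f y‖₊ : ℝ≥0∞) ^ p * ENNReal.ofReal (w y) := by
        rw [← ENNReal.tsum_mul_left]
        exact ENNReal.tsum_le_tsum fun x => rpow_mul_lintegral_enlarged_ball_le d hp hw hpos hf
          hlam x (hr0 x (huE x.2)) (hr x (huE x.2))
    _ = ENNReal.ofReal ((6 ^ d : ℝ) ^ p) * ApChar d p w *
        ∫⁻ y in ⋃ x ∈ u, Metric.closedBall x (r x),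
          (‖f y‖₊ : ℝ≥0∞) ^ p * ENNReal.ofReal (w y) := by
        rw [ENNReal.tsum_mul_left, lintegral_biUnion (s := fun x => Metric.closedBall x (r x)) hu
          (fun x _ => Metric.isClosed_closedBall.measurableSet) hdisj]
    _ ≤ _ := by
        gcongr
        exact Measure.restrict_le_self
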